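/- arXiv:1607.08429 — 7 statements merged into one kernel-verified Lean document; each statement's English description precedes it below -/
import Mathlib

section
/- Let k ≥ 1 be an integer, U ⊆ ℂ a nonempty connected open set, and g : U → ℂ holomorphic and not identically zero. If f₁, f₂ : U → ℂ are holomorphic, satisfy k·fᵢ′(z)·g(z) + fᵢ(z)·g′(z) = 0 for all z ∈ U (i = 1, 2), and f₁ is not identically zero, then there exists a constant c ∈ ℂ with f₂ = c·f₁ on U. In particular, the space of holomorphic solutions of this equation on U has dimension at most 1 over ℂ. -/
/-- For `k ≥ 1`, `U ⊆ ℂ` a nonempty connected open set, `g` holomorphic and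
not identically zero on `U`, if `f₁, f₂` are holomorphic solutions on `U` of
`k·f′·g + f·g′ = 0` with `f₁` not identically zero, then `f₂ = c·f₁` on `U` for some
constant `c ∈ ℂ`. -/
theorem stmt_1 (k : ℕ) (hk : 1 ≤ k) (U : Set ℂ) (hUopen : IsOpen U) (hUconn : IsConnected U)
    (g : ℂ → ℂ)
    (hg : ∀ z ∈ U, DifferentiableAt ℂ g z)
    (hg0 : ∃ z ∈ U, g z ≠ 0)
    (f₁ f₂ : ℂ → ℂ)
    (hf₁ : ∀ z ∈ U, DifferentiableAt ℂ f₁ z)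
    (hf₂ : ∀ z ∈ U, DifferentiableAt ℂ f₂ z)
    (heq₁ : ∀ z ∈ U, (k : ℂ) * deriv f₁ z * g z + f₁ z * deriv g z = 0)
    (heq₂ : ∀ z ∈ U, (k : ℂ) * deriv f₂ z * g z + f₂ z * deriv g z = 0)
    (hf₁0 : ∃ z ∈ U, f₁ z ≠ 0) :
    ∃ c : ℂ, ∀ z ∈ U, f₂ z = c * f₁ z := by
  have ana : ∀ h : ℂ → ℂ, (∀ z ∈ U, DifferentiableAt ℂ h z) → AnalyticOnNhd ℂ h U := fun h hh =>
    DifferentiableOn.analyticOnNhd (fun z hz => (hh z hz).differentiableWithinAt) hUopen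
  have ag := ana g hg
  have a1 := ana f₁ hf₁
  have a2 := ana f₂ hf₂
  have hk0 : (k : ℂ) ≠ 0 := by exact_mod_cast (by omega : k ≠ 0)
  have aW : AnalyticOnNhd ℂ (f₁ * deriv f₂ - f₂ * deriv f₁) U :=
    (a1.mul a2.deriv).sub (a2.mul a1.deriv)
  have hW : ∀ z ∈ U, f₁ z * deriv f₂ z - f₂ z * deriv f₁ z = 0 := by
    have hmul : ∀ z ∈ U, (g * (f₁ * deriv f₂ - f₂ * deriv f₁)) z = 0 := by
      intro z hz
      have e : (k : ℂ) * (g z * (f₁ z * deriv f₂ z - f₂ z * deriv f₁ z)) = 0 := by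
        linear_combination f₁ z * heq₂ z hz - f₂ z * heq₁ z hz
      simpa using (mul_eq_zero.mp e).resolve_left hk0
    rcases ag.eq_zero_or_eq_zero_of_mul_eq_zero aW hmul hUconn.isPreconnected with h | h
    · obtain ⟨z, hz, hne⟩ := hg0
      exact absurd (h z hz) hne
    · intro z hz
      simpa using h z hz
  obtain ⟨z₀, hz₀, hne⟩ := hf₁0
  have hnb : ∀ᶠ z in nhds z₀, z ∈ U ∧ f₁ z ≠ 0 :=
    (hUopen.eventually_mem hz₀).and ((hf₁ z₀ hz₀).continuousAt.eventually_ne hne)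
  obtain ⟨r, hr, hball⟩ := Metric.eventually_nhds_iff_ball.mp hnb
  have hd : ∀ z ∈ Metric.ball z₀ r, HasDerivAt (fun z => f₂ z / f₁ z) 0 z := by
    intro z hz
    obtain ⟨hzU, hz1⟩ := hball z hz
    have h := (hf₂ z hzU).hasDerivAt.div (hf₁ z hzU).hasDerivAt hz1
    have e : deriv f₂ z * f₁ z - f₂ z * deriv f₁ z = 0 := by
      linear_combination hW z hzU
    rw [e, zero_div] at h
    exact h
  obtain ⟨c, hc⟩ := Metric.isOpen_ball.exists_is_const_of_deriv_eq_zero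
    (convex_ball z₀ r).isPreconnected
    (fun z hz => (hd z hz).differentiableAt.differentiableWithinAt)
    (fun z hz => (hd z hz).deriv)
  refine ⟨c, ?_⟩
  have ac : AnalyticOnNhd ℂ (fun z => c * f₁ z) U := analyticOnNhd_const.mul a1
  refine a2.eqOn_of_preconnected_of_eventuallyEq ac hUconn.isPreconnected hz₀ ?_
  filter_upwards [Metric.ball_mem_nhds z₀ hr] with z hz
  exact (div_eq_iff (hball z hz).2).mp (hc z hz)
end

section
/- Let k ≥ 1 and b be integers, and let g be meromorphic at 0 of order b. Then the following are equivalent: (i) there exist ρ > 0 and a holomorphic function f on B(0,ρ), not identically zero, such that k·f′(z)·g(z) + f(z)·g′(z) = 0 for all z ∈ B(0,ρ)∖{0}; (ii) b ≤ 0 and k divides b. Moreover, any such f vanishes at 0 to order exactly −b/k (so in particular f(0) ≠ 0 when b = 0). -/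
/-- A function `g` is meromorphic at `0` of order `b ∈ ℤ` if on some punctured ball
`B(0,ρ)∖{0}` one has `g(z) = z^b·g̃(z)` with `g̃` holomorphic on `B(0,ρ)` and `g̃(0) ≠ 0`. -/
def MeromorphicAtZeroOfOrder (g : ℂ → ℂ) (b : ℤ) : Prop :=
  ∃ ρ > (0 : ℝ), ∃ gt : ℂ → ℂ,
    (∀ z ∈ Metric.ball (0 : ℂ) ρ, DifferentiableAt ℂ gt z) ∧ gt 0 ≠ 0 ∧
    ∀ z ∈ Metric.ball (0 : ℂ) ρ \ {0}, g z = z ^ b * gt z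

open Filter Topology in
lemma aux_deriv (h t : ℂ → ℂ) (m : ℤ) (z : ℂ) (hz : z ≠ 0) (ht : DifferentiableAt ℂ t z)
    (he : h =ᶠ[𝓝 z] fun w => w ^ m * t w) :
    z * deriv h z = z ^ m * (m * t z + z * deriv t z) := by
  have h1 := (hasDerivAt_zpow m z (Or.inl hz)).mul ht.hasDerivAt
  have h2 : deriv h z = _ := (h1.congr_of_eventuallyEq he).deriv
  rw [h2]
  have : z ^ m = z ^ (m - 1) * z := by
    rw [← zpow_add_one₀ hz]; simp
  rw [this]; ring

lemma aux_nhds (ρ : ℝ) (z : ℂ) (hz : z ∈ Metric.ball (0 : ℂ) ρ \ {0}) :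
    Metric.ball (0 : ℂ) ρ \ {0} ∈ nhds z :=
  (Metric.isOpen_ball.sdiff isClosed_singleton).mem_nhds hz

open Filter Topology in
lemma aux_core (k : ℕ) (b : ℤ) (g : ℂ → ℂ)
    (hg : MeromorphicAtZeroOfOrder g b) (ρ : ℝ) (hρ : 0 < ρ) (f : ℂ → ℂ)
    (hf : ∀ z ∈ Metric.ball (0 : ℂ) ρ, DifferentiableAt ℂ f z)
    (hne : ∃ z ∈ Metric.ball (0 : ℂ) ρ, f z ≠ 0)
    (hode : ∀ z ∈ Metric.ball (0 : ℂ) ρ \ {0},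
        (k : ℂ) * deriv f z * g z + f z * deriv g z = 0) :
    ∃ n : ℕ, (k : ℤ) * n + b = 0 ∧ ∃ ρ' > (0 : ℝ), ρ' ≤ ρ ∧ ∃ ft : ℂ → ℂ,
        (∀ z ∈ Metric.ball (0 : ℂ) ρ', DifferentiableAt ℂ ft z) ∧ ft 0 ≠ 0 ∧
        ∀ z ∈ Metric.ball (0 : ℂ) ρ', f z = z ^ n * ft z := by
  obtain ⟨r, hr, gt, hgt, hgt0, hgeq⟩ := hg
  have hfd : DifferentiableOn ℂ f (Metric.ball 0 ρ) :=
    fun z hz => (hf z hz).differentiableWithinAt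
  have hfa : AnalyticOnNhd ℂ f (Metric.ball 0 ρ) := hfd.analyticOnNhd Metric.isOpen_ball
  have h0 : (0 : ℂ) ∈ Metric.ball (0 : ℂ) ρ := Metric.mem_ball_self hρ
  have hnz : ¬ ∀ᶠ z in 𝓝 (0 : ℂ), f z = 0 := by
    intro hc
    obtain ⟨z, hz, hz'⟩ := hne
    exact hz' (hfa.eqOn_zero_of_preconnected_of_eventuallyEq_zero
      (convex_ball (0 : ℂ) ρ).isPreconnected h0 hc hz)
  obtain ⟨n, ft, hft, hft0, hfteq⟩ :=
    (hfa 0 h0).exists_eventuallyEq_pow_smul_nonzero_iff.mpr hnz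
  have hev := hft.eventually_analyticAt.and hfteq
  obtain ⟨ε, hε, hball⟩ := Metric.eventually_nhds_iff_ball.mp hev
  have hfeq : ∀ z ∈ Metric.ball (0 : ℂ) ε, f z = z ^ n * ft z := by
    intro z hz; simpa using (hball z hz).2
  refine ⟨n, ?_, min ε ρ, lt_min hε hρ, min_le_right _ _, ft, ?_, hft0, ?_⟩
  · have hgta : AnalyticAt ℂ gt 0 := by
      have : DifferentiableOn ℂ gt (Metric.ball 0 r) :=
        fun z hz => (hgt z hz).differentiableWithinAt
      exact this.analyticOnNhd Metric.isOpen_ball 0 (Metric.mem_ball_self hr)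
    let F : ℂ → ℂ := fun z => ((k : ℂ) * n + b) * (ft z * gt z) +
      z * (k * deriv ft z * gt z + ft z * deriv gt z)
    have hFc : ContinuousAt F 0 := by
      have h1 := hft.continuousAt
      have h2 := hgta.continuousAt
      have h3 := hft.deriv.continuousAt
      have h4 := hgta.deriv.continuousAt
      fun_prop
    have hF0 : ∀ᶠ z in 𝓝[≠] (0 : ℂ), F z = 0 := by
      have e1 : ∀ᶠ z in 𝓝[≠] (0 : ℂ), z ∈ Metric.ball (0 : ℂ) ε :=
        nhdsWithin_le_nhds (Metric.ball_mem_nhds _ hε)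
      have e2 : ∀ᶠ z in 𝓝[≠] (0 : ℂ), z ∈ Metric.ball (0 : ℂ) r :=
        nhdsWithin_le_nhds (Metric.ball_mem_nhds _ hr)
      have e3 : ∀ᶠ z in 𝓝[≠] (0 : ℂ), z ∈ Metric.ball (0 : ℂ) ρ :=
        nhdsWithin_le_nhds (Metric.ball_mem_nhds _ hρ)
      filter_upwards [e1, e2, e3, self_mem_nhdsWithin] with z z1 z2 z3 z4
      have hz : z ≠ 0 := z4
      have d1 := aux_deriv f ft n z hz (hball z z1).1.differentiableAt (by
        filter_upwards [Metric.isOpen_ball.mem_nhds z1] with w hw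
        simpa using hfeq w hw)
      have d2 := aux_deriv g gt b z hz (hgt z z2) (by
        filter_upwards [aux_nhds r z ⟨z2, hz⟩] with w hw
        exact hgeq w hw)
      have o := hode z ⟨z3, hz⟩
      have ff := hfeq z z1
      have gg := hgeq z ⟨z2, hz⟩
      rw [zpow_natCast] at d1
      have key : z ^ n * z ^ b * F z = 0 := by
        have : z ^ n * z ^ b * F z = z * ((k : ℂ) * deriv f z * g z + f z * deriv g z) := by
          have : z * ((k : ℂ) * deriv f z * g z + f z * deriv g z)
            = k * (z * deriv f z) * g z + f z * (z * deriv g z) := by ring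
          rw [this, d1, d2, ff, gg]
          simp only [F]
          push_cast
          ring
        rw [this, o, mul_zero]
      exact (mul_eq_zero.mp key).resolve_left
        (mul_ne_zero (pow_ne_zero _ hz) (zpow_ne_zero _ hz))
    have hlim : F 0 = 0 := by
      refine tendsto_nhds_unique (hFc.tendsto.mono_left (nhdsWithin_le_nhds (s := {0}ᶜ))) ?_
      exact tendsto_const_nhds.congr' (hF0.mono fun z hz => hz.symm)
    have : ((k : ℂ) * n + b) * (ft 0 * gt 0) = 0 := by simpa [F] using hlim
    have := (mul_eq_zero.mp this).resolve_right (mul_ne_zero hft0 hgt0)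
    exact_mod_cast this
  · intro z hz
    exact (hball z (Metric.ball_subset_ball (min_le_left _ _) hz)).1.differentiableAt
  · intro z hz
    exact hfeq z (Metric.ball_subset_ball (min_le_left _ _) hz)

open Filter Topology in
lemma aux_conv (k : ℕ) (hk : 1 ≤ k) (m : ℕ) (b : ℤ) (hb : (k : ℤ) * m + b = 0) (g : ℂ → ℂ)
    (hg : MeromorphicAtZeroOfOrder g b) :
    ∃ ρ > (0 : ℝ), ∃ f : ℂ → ℂ,
        (∀ z ∈ Metric.ball (0 : ℂ) ρ, DifferentiableAt ℂ f z) ∧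
        (∃ z ∈ Metric.ball (0 : ℂ) ρ, f z ≠ 0) ∧
        ∀ z ∈ Metric.ball (0 : ℂ) ρ \ {0},
          (k : ℂ) * deriv f z * g z + f z * deriv g z = 0 := by
  obtain ⟨r, hr, gt, hgt, hgt0, hgeq⟩ := hg
  have hk0 : (k : ℂ) ≠ 0 := by exact_mod_cast (by omega : k ≠ 0)
  have hc : ContinuousAt (fun z => gt z / gt 0) 0 :=
    ((hgt 0 (Metric.mem_ball_self hr)).continuousAt).div_const _
  have hs : ∀ᶠ z in 𝓝 (0 : ℂ), gt z / gt 0 ∈ Complex.slitPlane := by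
    apply hc.eventually_mem
    apply Complex.isOpen_slitPlane.mem_nhds
    simp [div_self hgt0]
  obtain ⟨ε, hε, hball⟩ := Metric.eventually_nhds_iff_ball.mp
    (hs.and (Metric.ball_mem_nhds (0 : ℂ) hr))
  let u : ℂ → ℂ := fun z => Complex.exp (-(1 / k : ℂ) * Complex.log (gt z / gt 0))
  have hu : ∀ z ∈ Metric.ball (0 : ℂ) ε, HasDerivAt u
      (u z * (-(1 / k : ℂ) * ((deriv gt z / gt 0) / (gt z / gt 0)))) z := by
    intro z hz
    have := ((((hgt z (hball z hz).2).hasDerivAt.div_const (gt 0)).clog (hball z hz).1).const_mul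
      (-(1 / k : ℂ))).cexp
    exact this
  refine ⟨ε, hε, fun z => z ^ m * u z, ?_, ?_, ?_⟩
  · intro z hz
    exact (differentiableAt_id.pow m).mul (hu z hz).differentiableAt
  · refine ⟨((ε / 2 : ℝ) : ℂ), ?_, ?_⟩
    · rw [mem_ball_zero_iff, Complex.norm_real, Real.norm_eq_abs, abs_of_pos (by positivity)]
      linarith
    · refine mul_ne_zero (pow_ne_zero _ ?_) (Complex.exp_ne_zero _)
      exact_mod_cast (by positivity : ε / 2 ≠ 0)
  · rintro z ⟨hz, hz0 : z ≠ 0⟩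
    have hgz : gt z ≠ 0 := by
      intro h
      have := (hball z hz).1
      simp [h] at this
    have d1 := aux_deriv (fun z => z ^ m * u z) u m z hz0 (hu z hz).differentiableAt
      (by simp)
    have d2 := aux_deriv g gt b z hz0 (hgt z (hball z hz).2) (by
        filter_upwards [aux_nhds r z ⟨(hball z hz).2, hz0⟩] with w hw
        exact hgeq w hw)
    have gg := hgeq z ⟨(hball z hz).2, hz0⟩
    have du := (hu z hz).deriv
    have hdu2 : (k : ℂ) * deriv u z * gt z + u z * deriv gt z = 0 := by
      rw [du]; field_simp; ring
    have hb2 : (k : ℂ) * m + b = 0 := by exact_mod_cast hb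
    rw [zpow_natCast] at d1
    refine (mul_eq_zero.mp (?_ : z * _ = 0)).resolve_left hz0
    set D := deriv (fun z => z ^ m * u z) z
    have : z * ((k : ℂ) * D * g z + z ^ m * u z * deriv g z)
      = k * (z * D) * g z + z ^ m * u z * (z * deriv g z) := by ring
    refine this.trans ?_
    rw [d1, d2, gg]
    push_cast
    linear_combination z ^ m * z ^ b * u z * gt z * hb2 + z ^ m * z ^ b * z * hdu2

/-- For `k ≥ 1` and `g` meromorphic at `0` of order `b`, there is a
holomorphic, not identically zero, solution `f` of `k·f′·g + f·g′ = 0` on some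
punctured ball around `0` iff `b ≤ 0` and `k ∣ b`; moreover any such `f` vanishes
at `0` to order exactly `−b/k`. -/
theorem stmt_2 (k : ℕ) (hk : 1 ≤ k) (b : ℤ) (g : ℂ → ℂ)
    (hg : MeromorphicAtZeroOfOrder g b) :
    ((∃ ρ > (0 : ℝ), ∃ f : ℂ → ℂ,
        (∀ z ∈ Metric.ball (0 : ℂ) ρ, DifferentiableAt ℂ f z) ∧
        (∃ z ∈ Metric.ball (0 : ℂ) ρ, f z ≠ 0) ∧
        ∀ z ∈ Metric.ball (0 : ℂ) ρ \ {0},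
          (k : ℂ) * deriv f z * g z + f z * deriv g z = 0) ↔
      (b ≤ 0 ∧ (k : ℤ) ∣ b)) ∧
    (∀ ρ > (0 : ℝ), ∀ f : ℂ → ℂ,
      (∀ z ∈ Metric.ball (0 : ℂ) ρ, DifferentiableAt ℂ f z) →
      (∃ z ∈ Metric.ball (0 : ℂ) ρ, f z ≠ 0) →
      (∀ z ∈ Metric.ball (0 : ℂ) ρ \ {0},
        (k : ℂ) * deriv f z * g z + f z * deriv g z = 0) →
      ∃ ρ' > (0 : ℝ), ρ' ≤ ρ ∧ ∃ ft : ℂ → ℂ,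
        (∀ z ∈ Metric.ball (0 : ℂ) ρ', DifferentiableAt ℂ ft z) ∧ ft 0 ≠ 0 ∧
        ∀ z ∈ Metric.ball (0 : ℂ) ρ', f z = z ^ ((-b) / (k : ℤ)).toNat * ft z) := by
  refine ⟨⟨?_, ?_⟩, ?_⟩
  · rintro ⟨ρ, hρ, f, hf, hne, hode⟩
    obtain ⟨n, hn, -⟩ := aux_core k b g hg ρ hρ f hf hne hode
    have : 0 ≤ (k : ℤ) * n := by positivity
    exact ⟨by linarith, ⟨-n, by linarith⟩⟩
  · rintro ⟨hb, c, hc⟩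
    have hc0 : c ≤ 0 := by
      by_contra h
      push Not at h
      have : 0 < (k : ℤ) * c := mul_pos (by omega) h
      omega
    refine aux_conv k hk (-c).toNat b ?_ g hg
    rw [Int.toNat_of_nonneg (by omega), hc]; ring
  · intro ρ hρ f hf hne hode
    obtain ⟨n, hn, h⟩ := aux_core k b g hg ρ hρ f hf hne hode
    have : ((-b) / (k : ℤ)).toNat = n := by
      have h1 : -b = (k : ℤ) * n := by linarith
      rw [h1, Int.mul_ediv_cancel_left _ (by omega)]; simp
    rw [this]; exact h
end

section
/- Let k ≥ 1 and b be integers, let g be meromorphic at 0 of order b, and let h be holomorphic on a neighborhood of 0. Assume that b ≥ 0 or that k does not divide b. Then there exist ρ > 0 and a holomorphic function f on B(0,ρ) with f(0) = 0 such that k·f′(z)·g(z) + f(z)·g′(z) = g(z)·h(z) for all z ∈ B(0,ρ)∖{0}. -/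
theorem aux_ode (k : ℕ) (b : ℤ) (hne : ∀ n : ℕ, (k : ℤ) * n + k + b ≠ 0) (P : ℂ → ℂ) (R : ℝ)
    (hR : 0 < R) (hP : DifferentiableOn ℂ P (Metric.ball 0 R)) :
    ∃ W : ℂ → ℂ, (∀ z ∈ Metric.ball (0 : ℂ) (R / 2), DifferentiableAt ℂ W z) ∧
      ∀ z ∈ Metric.ball (0 : ℂ) (R / 2), (k : ℂ) * z * deriv W z + (k + b) * W z = P z := by
  set a : ℕ → ℂ := fun n => (n.factorial : ℂ)⁻¹ * iteratedDeriv n P 0 with ha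
  have hs : ∀ z ∈ Metric.ball (0 : ℂ) R, HasSum (fun n => a n * z ^ n) (P z) := by
    intro z hz
    have := Complex.hasSum_taylorSeries_on_ball hP hz
    have he : (fun n => a n * z ^ n) =
        fun n : ℕ => (n.factorial : ℂ)⁻¹ • (z - 0) ^ n • iteratedDeriv n P 0 := by
      funext n
      simp only [ha, smul_eq_mul, sub_zero]; ring
    rw [he]
    exact this
  set d : ℕ → ℂ := fun n => (k : ℂ) * n + k + b with hd
  have hd0 : ∀ n, d n ≠ 0 := by
    intro n hn
    apply hne n
    have : (((k : ℤ) * n + k + b : ℤ) : ℂ) = 0 := by push_cast; exact hn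
    exact_mod_cast this
  have hd1 : ∀ n, 1 ≤ ‖d n‖ := by
    intro n
    have h1 : d n = (((k : ℤ) * n + k + b : ℤ) : ℂ) := by simp [hd]
    rw [h1, Complex.norm_intCast]
    exact_mod_cast Int.one_le_abs (hne n)
  set F : ℕ → ℂ → ℂ := fun n z => a n / d n * z ^ n with hF
  set u : ℕ → ℝ := fun n => ‖a n * ((R / 2 : ℝ) : ℂ) ^ n‖ with hu
  have hus : Summable u := by
    apply Summable.norm
    refine (hs ((R / 2 : ℝ) : ℂ) ?_).summable
    rw [mem_ball_zero_iff, Complex.norm_real, Real.norm_of_nonneg (by linarith)]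
    linarith
  have hFd : ∀ n, DifferentiableOn ℂ (F n) (Metric.ball 0 (R / 2)) := by
    intro n
    simp only [hF]
    fun_prop
  have hle : ∀ n w, w ∈ Metric.ball (0 : ℂ) (R / 2) → ‖F n w‖ ≤ u n := by
    intro n w hw
    rw [mem_ball_zero_iff] at hw
    simp only [hF, hu]
    rw [norm_mul, norm_mul, norm_pow, norm_pow, norm_div, Complex.norm_real,
      Real.norm_of_nonneg (by linarith : 0 ≤ R / 2)]
    gcongr
    exact div_le_self (norm_nonneg _) (hd1 n)
  refine ⟨fun w => ∑' n, F n w, ?_, ?_⟩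
  · intro z hz
    exact (Complex.differentiableOn_tsum_of_summable_norm hus hFd Metric.isOpen_ball hle).differentiableAt
      (Metric.isOpen_ball.mem_nhds hz)
  · intro z hz
    have h1 := Complex.hasSum_deriv_of_summable_norm hus hFd Metric.isOpen_ball hle hz
    have h2 : HasSum (fun n => F n z) (∑' n, F n z) :=
      (Summable.of_norm_bounded hus (fun n => hle n z hz)).hasSum
    have h3 := (h1.mul_left ((k : ℂ) * z)).add (h2.mul_left ((k : ℂ) + b))
    refine h3.unique ?_
    have h6 := hs z (Metric.ball_subset_ball (by linarith) hz)
    refine (congrArg (fun q => HasSum q (P z)) ?_).mpr h6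
    funext n
    have h4 : z * deriv (F n) z = n * (a n / d n) * z ^ n := by
      simp only [hF]
      rw [deriv_const_mul _ (by fun_prop)]
      simp only [deriv_pow_field]
      cases n with
      | zero => simp
      | succ m => simp [pow_succ]; ring
    have h5 : a n / d n * d n = a n := div_mul_cancel₀ _ (hd0 n)
    rw [mul_assoc, h4]
    simp only [hF]
    calc _ = a n / d n * d n * z ^ n := by simp only [hd]; ring
      _ = _ := by rw [h5]

/-- For `k ≥ 1`, `g` meromorphic at `0` of order `b` with `b ≥ 0` or `k ∤ b`,
and `h` holomorphic near `0`, there exist `ρ > 0` and a holomorphic `f` on `B(0,ρ)` with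
`f(0) = 0` solving `k·f′·g + f·g′ = g·h` on `B(0,ρ)∖{0}`. -/
theorem stmt_3 (k : ℕ) (hk : 1 ≤ k) (b : ℤ) (g : ℂ → ℂ)
    (hg : MeromorphicAtZeroOfOrder g b)
    (h : ℂ → ℂ)
    (hh : ∃ ρ > (0 : ℝ), ∀ z ∈ Metric.ball (0 : ℂ) ρ, DifferentiableAt ℂ h z)
    (hbk : 0 ≤ b ∨ ¬ ((k : ℤ) ∣ b)) :
    ∃ ρ > (0 : ℝ), ∃ f : ℂ → ℂ,
      (∀ z ∈ Metric.ball (0 : ℂ) ρ, DifferentiableAt ℂ f z) ∧ f 0 = 0 ∧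
      ∀ z ∈ Metric.ball (0 : ℂ) ρ \ {0},
        (k : ℂ) * deriv f z * g z + f z * deriv g z = g z * h z := by
  obtain ⟨ρ₁, hρ₁, gt, hgt, hgt0, hgeq⟩ := hg
  obtain ⟨ρ₂, hρ₂, hh⟩ := hh
  have hne : ∀ n : ℕ, (k : ℤ) * n + k + b ≠ 0 := by
    intro n hn
    rcases hbk with hb | hb
    · have : 0 ≤ (k : ℤ) * n := by positivity
      omega
    · exact hb ⟨-(n + 1), by linarith⟩
  have hk0 : (k : ℂ) ≠ 0 := by exact_mod_cast (by omega : k ≠ 0)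
  have hcont : ContinuousAt (fun z => gt z / gt 0) 0 :=
    ((hgt 0 (Metric.mem_ball_self hρ₁)).continuousAt).div_const _
  have hev : ∀ᶠ z in nhds (0 : ℂ), gt z / gt 0 ∈ Complex.slitPlane := by
    apply hcont.eventually_mem
    apply Complex.isOpen_slitPlane.mem_nhds
    simp [hgt0]
  obtain ⟨ρ₃, hρ₃, hsl⟩ := Metric.eventually_nhds_iff_ball.mp hev
  set R := min ρ₁ (min ρ₂ ρ₃) with hRdef
  have hR : 0 < R := by simp only [hRdef]; positivity
  have hR1 : Metric.ball (0 : ℂ) R ⊆ Metric.ball 0 ρ₁ := Metric.ball_subset_ball (by simp [hRdef])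
  have hR2 : Metric.ball (0 : ℂ) R ⊆ Metric.ball 0 ρ₂ := Metric.ball_subset_ball (by simp [hRdef])
  have hR3 : Metric.ball (0 : ℂ) R ⊆ Metric.ball 0 ρ₃ := Metric.ball_subset_ball (by simp [hRdef])
  set L : ℂ → ℂ := fun z => Complex.log (gt z / gt 0) / k with hL
  have hLd : ∀ z ∈ Metric.ball (0 : ℂ) R,
      HasDerivAt L (deriv gt z / gt 0 / (gt z / gt 0) / k) z := fun z hz =>
    (((hgt z (hR1 hz)).hasDerivAt.div_const (gt 0)).clog (hsl z (hR3 hz))).div_const _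
  obtain ⟨W, hW, hWeq⟩ := aux_ode k b hne (fun z => h z * Complex.exp (L z)) R hR (by
    intro z hz
    exact ((hh z (hR2 hz)).mul (hLd z hz).differentiableAt.cexp).differentiableWithinAt)
  have hsub : Metric.ball (0 : ℂ) (R / 2) ⊆ Metric.ball 0 R :=
    Metric.ball_subset_ball (by linarith)
  have hfd : ∀ z ∈ Metric.ball (0 : ℂ) (R / 2),
      HasDerivAt (fun z => z * W z * Complex.exp (-L z))
        ((1 * W z + z * deriv W z) * Complex.exp (-L z) + z * W z * (Complex.exp (-L z) *
          -(deriv gt z / gt 0 / (gt z / gt 0) / k))) z := fun z hz =>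
    ((hasDerivAt_id' z).mul (hW z hz).hasDerivAt).mul (hLd z (hsub hz)).neg.cexp
  refine ⟨R / 2, by linarith, fun z => z * W z * Complex.exp (-L z),
    fun z hz => (hfd z hz).differentiableAt, by simp, ?_⟩
  rintro z ⟨hz, hz0⟩
  have hz0' : z ≠ 0 := hz0
  have hgz : gt z ≠ 0 := by
    intro h0
    have := hsl z (hR3 (hsub hz))
    simp [h0] at this
  have hgd : HasDerivAt g (b * z ^ (b - 1) * gt z + z ^ b * deriv gt z) z := by
    refine ((hasDerivAt_zpow b z (Or.inl hz0')).mul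
      (hgt z (hR1 (hsub hz))).hasDerivAt).congr_of_eventuallyEq ?_
    have ho : IsOpen (Metric.ball (0 : ℂ) ρ₁ \ {0}) := Metric.isOpen_ball.sdiff isClosed_singleton
    filter_upwards [ho.mem_nhds ⟨hR1 (hsub hz), hz0⟩] with w hw
    exact hgeq w hw
  rw [(hfd z hz).deriv, hgd.deriv, hgeq z ⟨hR1 (hsub hz), hz0⟩, zpow_sub_one₀ hz0']
  have hE : Complex.exp (L z) * Complex.exp (-L z) = 1 := by
    rw [← Complex.exp_add]; simp
  have hw := hWeq z hz
  have hh' : h z = (k * z * deriv W z + (k + b) * W z) * Complex.exp (-L z) := by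
    rw [hw, mul_assoc, hE, mul_one]
  rw [hh']
  field_simp
  ring
end

section
/- Let k ≥ 1 and b be integers with k not dividing b, and let φ be holomorphic on a neighborhood of 0 in ℂ. Then there exist ρ > 0 and a holomorphic function F on B(0,ρ)∖{0} such that F′(u) = u^{k+b−1}·φ(u^k) for all u ∈ B(0,ρ)∖{0}, where u^{k+b−1} denotes the integer power (allowing negative exponents). -/
theorem stmt_5_aux (k : ℕ) (hk : 1 ≤ k) (ρ : ℝ) (hρ : 0 < ρ) (hρ1 : ρ ≤ 1) (N : ℕ) :
    ∀ (b : ℤ), ¬ ((k : ℤ) ∣ b) → 0 ≤ (k : ℤ) + b - 1 + k * N → ∀ φ : ℂ → ℂ,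
    DifferentiableOn ℂ φ (Metric.ball 0 ρ) →
    ∃ F : ℂ → ℂ, ∀ u ∈ Metric.ball (0 : ℂ) ρ \ {0},
      HasDerivAt F (u ^ ((k : ℤ) + b - 1) * φ (u ^ k)) u := by
  have hmaps : Set.MapsTo (fun u : ℂ => u ^ k) (Metric.ball 0 ρ) (Metric.ball 0 ρ) := by
    intro u hu
    simp only [Metric.mem_ball, dist_zero_right, norm_pow] at hu ⊢
    exact lt_of_le_of_lt (pow_le_of_le_one (norm_nonneg _) (by linarith) (by omega)) hu
  induction N with
  | zero =>
    intro b hb hm φ hφ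
    obtain ⟨m, hm'⟩ := Int.eq_ofNat_of_zero_le (a := (k : ℤ) + b - 1) (by simpa using hm)
    have hd : DifferentiableOn ℂ (fun u : ℂ => u ^ m * φ (u ^ k)) (Metric.ball 0 ρ) :=
      (by fun_prop : DifferentiableOn ℂ (fun u : ℂ => u ^ m) _).mul
        (hφ.comp (by fun_prop) hmaps)
    obtain ⟨F, hF⟩ := hd.isExactOn_ball
    refine ⟨F, fun u hu => ?_⟩
    rw [hm', zpow_natCast]
    exact hF u hu.1
  | succ N ih =>
    intro b hb hm φ hφ
    have hψ : DifferentiableOn ℂ (dslope φ 0) (Metric.ball 0 ρ) :=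
      (Complex.differentiableOn_dslope (Metric.ball_mem_nhds 0 hρ)).2 hφ
    obtain ⟨G, hG⟩ := ih (b + k) (by simpa using hb) (by push_cast at hm; linarith) _ hψ
    have hne : (k : ℤ) + b ≠ 0 := by
      intro h
      exact hb ⟨-1, by linarith⟩
    have hne' : (((k : ℤ) + b : ℤ) : ℂ) ≠ 0 := by exact_mod_cast hne
    refine ⟨fun u => φ 0 / (((k : ℤ) + b : ℤ) : ℂ) * u ^ ((k : ℤ) + b) + G u, fun u hu => ?_⟩
    have hu0 : u ≠ 0 := hu.2
    have h1 := ((hasDerivAt_zpow ((k : ℤ) + b) u (Or.inl hu0)).const_mul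
      (φ 0 / (((k : ℤ) + b : ℤ) : ℂ))).add (hG u hu)
    refine h1.congr_deriv ?_
    have h2 := sub_smul_dslope φ 0 (u ^ k)
    simp only [sub_zero, smul_eq_mul] at h2
    have h3 : u ^ ((k : ℤ) + (b + k) - 1) = u ^ ((k : ℤ) + b - 1) * u ^ k := by
      rw [← zpow_natCast u k, ← zpow_add₀ hu0]
      congr 1
      ring
    rw [h3, mul_assoc _ (u ^ k), h2, ← mul_assoc, div_mul_cancel₀ _ hne']
    ring


/-- For `k ≥ 1` and `b` integers with `k ∤ b`, and `φ` holomorphic near `0`,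
there exist `ρ > 0` and a holomorphic `F` on `B(0,ρ)∖{0}` with
`F′(u) = u^{k+b−1}·φ(u^k)` on `B(0,ρ)∖{0}` (integer power, possibly negative exponent). -/
theorem stmt_5 (k : ℕ) (hk : 1 ≤ k) (b : ℤ) (hkb : ¬ ((k : ℤ) ∣ b))
    (φ : ℂ → ℂ)
    (hφ : ∃ ρ > (0 : ℝ), ∀ z ∈ Metric.ball (0 : ℂ) ρ, DifferentiableAt ℂ φ z) :
    ∃ ρ > (0 : ℝ), ∃ F : ℂ → ℂ,
      (∀ u ∈ Metric.ball (0 : ℂ) ρ \ {0}, DifferentiableAt ℂ F u) ∧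
      ∀ u ∈ Metric.ball (0 : ℂ) ρ \ {0},
        deriv F u = u ^ ((k : ℤ) + b - 1) * φ (u ^ k) := by
  obtain ⟨R, hR, hd⟩ := hφ
  have hρ : 0 < min R 1 := lt_min hR one_pos
  obtain ⟨F, hF⟩ := stmt_5_aux k hk (min R 1) hρ (min_le_right _ _) (k + b - 1).natAbs b hkb
    (by
      have h1 : (1 : ℤ) ≤ k := by exact_mod_cast hk
      have h2 : -((k : ℤ) + b - 1) ≤ ((k + b - 1).natAbs : ℤ) := by omega
      nlinarith [Int.natCast_nonneg ((k : ℤ) + b - 1).natAbs]) φ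
    (fun z hz => (hd z (Metric.ball_subset_ball (min_le_left _ _) hz)).differentiableWithinAt)
  exact ⟨min R 1, hρ, F, fun u hu => (hF u hu).differentiableAt, fun u hu => (hF u hu).deriv⟩
end

section
/- Let k ≥ 1 be an integer and R > 0. Let g be holomorphic and nonvanishing on B(0,R)∖{0}, and let f₀ be holomorphic on B(0,R) with f₀(0) = 0, f₀ not identically zero, and k·f₀′(z)·g(z) + f₀(z)·g′(z) = 0 for all z ∈ B(0,R)∖{0}. Then there is no holomorphic function f on B(0,R)∖{0} satisfying k·f′(z)·g(z) + f(z)·g′(z) = (k·f₀(z)/z)·g(z) for all z ∈ B(0,R)∖{0}. -/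
/-- For `k ≥ 1`, `R > 0`, `g` holomorphic and nonvanishing on `B(0,R)∖{0}`,
and `f₀` holomorphic on `B(0,R)` with `f₀(0) = 0`, `f₀` not identically zero, solving
`k·f₀′·g + f₀·g′ = 0` on the punctured ball, there is no holomorphic `f` on `B(0,R)∖{0}`
with `k·f′·g + f·g′ = (k·f₀/z)·g` there. -/
theorem stmt_7 (k : ℕ) (hk : 1 ≤ k) (R : ℝ) (hR : 0 < R) (g f₀ : ℂ → ℂ)
    (hg : ∀ z ∈ Metric.ball (0 : ℂ) R \ {0}, DifferentiableAt ℂ g z)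
    (hgne : ∀ z ∈ Metric.ball (0 : ℂ) R \ {0}, g z ≠ 0)
    (hf₀ : ∀ z ∈ Metric.ball (0 : ℂ) R, DifferentiableAt ℂ f₀ z)
    (hf₀0 : f₀ 0 = 0)
    (hf₀ne : ∃ z ∈ Metric.ball (0 : ℂ) R, f₀ z ≠ 0)
    (heq₀ : ∀ z ∈ Metric.ball (0 : ℂ) R \ {0},
      (k : ℂ) * deriv f₀ z * g z + f₀ z * deriv g z = 0) :
    ¬ ∃ f : ℂ → ℂ,
        (∀ z ∈ Metric.ball (0 : ℂ) R \ {0}, DifferentiableAt ℂ f z) ∧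
        ∀ z ∈ Metric.ball (0 : ℂ) R \ {0},
          (k : ℂ) * deriv f z * g z + f z * deriv g z = ((k : ℂ) * f₀ z / z) * g z := by
  rintro ⟨f, hf, heq⟩
  have hkc : (k : ℂ) ≠ 0 := by
    exact_mod_cast (by omega : k ≠ 0)
  have han : AnalyticOnNhd ℂ f₀ (Metric.ball (0 : ℂ) R) :=
    DifferentiableOn.analyticOnNhd
      (fun z hz => (hf₀ z hz).differentiableWithinAt) Metric.isOpen_ball
  have h0mem : (0 : ℂ) ∈ Metric.ball (0 : ℂ) R := Metric.mem_ball_self hR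
  have hev : ∀ᶠ z in nhdsWithin (0 : ℂ) {0}ᶜ, f₀ z ≠ 0 := by
    rcases (han 0 h0mem).eventually_eq_zero_or_eventually_ne_zero with h | h
    · exfalso
      obtain ⟨w, hw, hne⟩ := hf₀ne
      exact hne (han.eqOn_zero_of_preconnected_of_eventuallyEq_zero
        (convex_ball (0 : ℂ) R).isPreconnected h0mem h hw)
    · exact h
  rw [eventually_nhdsWithin_iff, Metric.eventually_nhds_iff] at hev
  obtain ⟨ε, hε, hne⟩ := hev
  obtain ⟨r, hr0, hr⟩ := exists_between (lt_min hε hR)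
  have hrε : r < ε := lt_of_lt_of_le hr (min_le_left _ _)
  have hrR : r < R := lt_of_lt_of_le hr (min_le_right _ _)
  have hint : (∮ z in C((0 : ℂ), r), (z - 0)⁻¹) = 0 := by
    refine circleIntegral.integral_eq_zero_of_hasDerivWithinAt
      (f := fun z => f z / f₀ z) hr0.le ?_
    intro z hz
    have hzr : dist z 0 = r := hz
    have hz0 : z ≠ 0 := by
      rintro rfl
      rw [dist_self] at hzr
      exact hr0.ne hzr
    have hzb : z ∈ Metric.ball (0 : ℂ) R := by
      rw [Metric.mem_ball, hzr]; exact hrR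
    have hzp : z ∈ Metric.ball (0 : ℂ) R \ {0} := ⟨hzb, hz0⟩
    have hfz : f₀ z ≠ 0 := hne (by rw [hzr]; exact hrε) hz0
    have hd := (hf z hzp).hasDerivAt.div (hf₀ z hzb).hasDerivAt hfz
    have hval : (deriv f z * f₀ z - f z * deriv f₀ z) / f₀ z ^ 2 = (z - 0)⁻¹ := by
      have h1 := heq z hzp
      have h2 := heq₀ z hzp
      have hgz := hgne z hzp
      rw [sub_zero, div_eq_iff (pow_ne_zero 2 hfz)]
      apply mul_left_cancel₀ (mul_ne_zero hkc hgz)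
      rw [div_eq_mul_inv] at h1
      linear_combination f₀ z * h1 - f z * h2
    rw [hval] at hd
    exact hd.hasDerivWithinAt
  rw [circleIntegral.integral_sub_center_inv 0 hr0.ne'] at hint
  exact Complex.two_pi_I_ne_zero hint
end

section
/- Let g be holomorphic on a neighborhood of 0 in ℂ with g(0) = 1. Then there exist ρ > 0 and a holomorphic function x on B(0,ρ) with x(0) = 0 and x′(0) ≠ 0 such that w·x′(w)·g(x(w)) = x(w) for all w ∈ B(0,ρ). -/
/-- For `g` holomorphic near `0` with `g(0) = 1`, there exist `ρ > 0` and a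
holomorphic `x` on `B(0,ρ)` with `x(0) = 0`, `x′(0) ≠ 0`, and
`w·x′(w)·g(x(w)) = x(w)` on `B(0,ρ)`. -/
theorem stmt_8 (g : ℂ → ℂ)
    (hg : ∃ ρ > (0 : ℝ), ∀ z ∈ Metric.ball (0 : ℂ) ρ, DifferentiableAt ℂ g z)
    (hg0 : g 0 = 1) :
    ∃ ρ > (0 : ℝ), ∃ x : ℂ → ℂ,
      (∀ w ∈ Metric.ball (0 : ℂ) ρ, DifferentiableAt ℂ x w) ∧
      x 0 = 0 ∧ deriv x 0 ≠ 0 ∧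
      ∀ w ∈ Metric.ball (0 : ℂ) ρ, w * deriv x w * g (x w) = x w := by
  obtain ⟨r, hr, hd⟩ := hg
  have hgd : DifferentiableOn ℂ g (Metric.ball 0 r) :=
    fun z hz => (hd z hz).differentiableWithinAt
  have hh : DifferentiableOn ℂ (dslope g 0) (Metric.ball 0 r) :=
    (Complex.differentiableOn_dslope (Metric.ball_mem_nhds 0 hr)).2 hgd
  obtain ⟨S, hS⟩ := hh.isExactOn_ball
  have hF : ∀ z ∈ Metric.ball (0 : ℂ) r,
      HasDerivAt (fun u => u * Complex.exp (S u)) (Complex.exp (S z) * g z) z := by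
    intro z hz
    have h1 := (hasDerivAt_id z).mul (hS z hz).cexp
    have h2 : z * dslope g 0 z = g z - 1 := by
      have := sub_smul_dslope g 0 z
      simpa [hg0] using this
    refine h1.congr_deriv ?_
    simp only [id]
    linear_combination Complex.exp (S z) * h2
  obtain ⟨F, hFdef⟩ : ∃ F : ℂ → ℂ, F = fun u => u * Complex.exp (S u) := ⟨_, rfl⟩
  rw [← hFdef] at hF
  have hF0 : F 0 = 0 := by simp [hFdef]
  have hmem : (0 : ℂ) ∈ Metric.ball (0 : ℂ) r := Metric.mem_ball_self hr
  have hFan : AnalyticAt ℂ F 0 :=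
    DifferentiableOn.analyticAt (s := Metric.ball 0 r)
      (fun z hz => (hF z hz).differentiableAt.differentiableWithinAt)
      (Metric.ball_mem_nhds 0 hr)
  have hF' : deriv F 0 ≠ 0 := by
    rw [(hF 0 hmem).deriv, hg0, mul_one]
    exact Complex.exp_ne_zero _
  have hxan := hFan.analyticAt_localInverse hF'
  have hxr := hFan.hasStrictDerivAt.eventually_right_inverse hF'
  have hxd := (hFan.hasStrictDerivAt.to_localInverse hF').hasDerivAt.deriv
  have hx0 : hFan.hasStrictDerivAt.localInverse _ _ _ hF' (F 0) = 0 :=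
    HasStrictFDerivAt.localInverse_apply_image ..
  generalize hFan.hasStrictDerivAt.localInverse _ _ _ hF' = x at *
  rw [hF0] at hxan hxr hxd hx0
  have hev : ∀ᶠ w in nhds (0 : ℂ), x w ∈ Metric.ball (0 : ℂ) r := by
    apply hxan.continuousAt.eventually_mem
    rw [hx0]
    exact Metric.ball_mem_nhds 0 hr
  have hall := (hxan.eventually_analyticAt.and hev).and hxr.eventually_nhds
  obtain ⟨ρ, hρ, hb⟩ := Metric.eventually_nhds_iff_ball.1 hall
  refine ⟨ρ, hρ, x, fun w hw => (hb w hw).1.1.differentiableAt, hx0, ?_, ?_⟩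
  · rw [hxd]
    exact inv_ne_zero hF'
  · intro w hw
    obtain ⟨⟨ha, hm⟩, he⟩ := hb w hw
    have hc := (hF (x w) hm).comp w ha.differentiableAt.hasDerivAt
    have hi : HasDerivAt (F ∘ x) 1 w := (hasDerivAt_id w).congr_of_eventuallyEq he
    have h1 := hc.unique hi
    have h2 : x w * Complex.exp (S (x w)) = w := by
      have := he.self_of_nhds
      rwa [hFdef] at this
    linear_combination x w * h1 - deriv x w * g (x w) * h2
end

section
/- Let k ≥ 1 be an integer and let f be holomorphic on a neighborhood of 0 in ℂ with f(0) = 1. Then there exist ρ > 0 and a holomorphic function x on B(0,ρ) with x(0) = 0 and x′(0) ≠ 0 such that f(x(w))·(w·x′(w))^k = x(w)^k for all w ∈ B(0,ρ); equivalently, in the new coordinate w the meromorphic k-differential a·f(x)·(dx/x)^k equals a·(dw/w)^k. -/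
/-- For `k ≥ 1` and `f` holomorphic near `0` with `f(0) = 1`, there exist
`ρ > 0` and a holomorphic `x` on `B(0,ρ)` with `x(0) = 0`, `x′(0) ≠ 0`, and
`f(x(w))·(w·x′(w))^k = x(w)^k` on `B(0,ρ)`; i.e. in the coordinate `w` the meromorphic
`k`-differential `a·f(x)·(dx/x)^k` equals `a·(dw/w)^k`. -/
theorem stmt_9 (k : ℕ) (hk : 1 ≤ k) (f : ℂ → ℂ)
    (hf : ∃ ρ > (0 : ℝ), ∀ z ∈ Metric.ball (0 : ℂ) ρ, DifferentiableAt ℂ f z)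
    (hf0 : f 0 = 1) :
    ∃ ρ > (0 : ℝ), ∃ x : ℂ → ℂ,
      (∀ w ∈ Metric.ball (0 : ℂ) ρ, DifferentiableAt ℂ x w) ∧
      x 0 = 0 ∧ deriv x 0 ≠ 0 ∧
      ∀ w ∈ Metric.ball (0 : ℂ) ρ, f (x w) * (w * deriv x w) ^ k = x w ^ k := by
  obtain ⟨r₁, hr₁, hf⟩ := hf
  have hkC : (k : ℂ) ≠ 0 := by exact_mod_cast (by omega : k ≠ 0)
  have hcont : ContinuousAt f 0 := (hf 0 (Metric.mem_ball_self hr₁)).continuousAt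
  have hslit : ∀ᶠ z in nhds (0 : ℂ), f z ∈ Complex.slitPlane := by
    apply hcont.eventually_mem
    rw [hf0]
    exact Complex.isOpen_slitPlane.mem_nhds Complex.one_mem_slitPlane
  obtain ⟨r₂, hr₂, hs⟩ := Metric.eventually_nhds_iff_ball.1 hslit
  obtain ⟨r, hr, hrr₁, hrr₂⟩ : ∃ r > (0 : ℝ), r ≤ r₁ ∧ r ≤ r₂ :=
    ⟨min r₁ r₂, lt_min hr₁ hr₂, min_le_left _ _, min_le_right _ _⟩
  have hmem0 : (0 : ℂ) ∈ Metric.ball (0 : ℂ) r := Metric.mem_ball_self hr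
  have hnhds : Metric.ball (0 : ℂ) r ∈ nhds (0 : ℂ) := Metric.ball_mem_nhds _ hr
  -- the k-th root of f
  let h : ℂ → ℂ := fun z => Complex.exp (Complex.log (f z) / k)
  have hh0 : h 0 = 1 := by simp [h, hf0]
  have hhne : ∀ z, h z ≠ 0 := fun z => Complex.exp_ne_zero _
  have hhk : ∀ z ∈ Metric.ball (0 : ℂ) r, h z ^ k = f z := by
    intro z hz
    have h1 : f z ≠ 0 := Complex.slitPlane_ne_zero (hs z (Metric.ball_subset_ball hrr₂ hz))
    simp only [h]
    rw [← Complex.exp_nat_mul, mul_div_cancel₀ _ hkC, Complex.exp_log h1]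
  have hhd : DifferentiableOn ℂ h (Metric.ball 0 r) := by
    intro z hz
    have h1 := hf z (Metric.ball_subset_ball hrr₁ hz)
    have h2 := hs z (Metric.ball_subset_ball hrr₂ hz)
    exact (((h1.clog h2).div_const _).cexp).differentiableWithinAt
  have hgd : DifferentiableOn ℂ (dslope h 0) (Metric.ball 0 r) :=
    (Complex.differentiableOn_dslope hnhds).2 hhd
  have hg : ∀ z, h z = 1 + z * dslope h 0 z := by
    intro z
    have := sub_smul_dslope h 0 z
    rw [hh0, sub_zero, smul_eq_mul] at this
    rw [this]; ring
  obtain ⟨G, hG⟩ := hgd.isExactOn_ball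
  let W : ℂ → ℂ := fun z => z * Complex.exp (G z)
  have hW0 : W 0 = 0 := by simp [W]
  have hW : ∀ z ∈ Metric.ball (0 : ℂ) r, HasDerivAt W (Complex.exp (G z) * h z) z := by
    intro z hz
    have h1 := (hasDerivAt_id z).mul (hG z hz).cexp
    refine h1.congr_deriv ?_
    rw [hg z]; simp only [id]; ring
  have hWne : ∀ z, Complex.exp (G z) * h z ≠ 0 := fun z =>
    mul_ne_zero (Complex.exp_ne_zero _) (hhne z)
  have hWan : AnalyticAt ℂ W 0 :=
    DifferentiableOn.analyticAt
      (fun z hz => (hW z hz).differentiableAt.differentiableWithinAt) hnhds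
  have hstrict : HasStrictDerivAt W (Complex.exp (G 0) * h 0) 0 := by
    have := hWan.hasStrictDerivAt
    rwa [(hW 0 hmem0).deriv] at this
  have hsf := hstrict.hasStrictFDerivAt_equiv (hWne 0)
  let e := hsf.toOpenPartialHomeomorph W
  have hecoe : (e : ℂ → ℂ) = W := rfl
  have h0s : (0 : ℂ) ∈ e.source := hsf.mem_toOpenPartialHomeomorph_source
  have h0t : (0 : ℂ) ∈ e.target := by
    have := e.map_source h0s
    rwa [hecoe, hW0] at this
  have hx0 : e.symm 0 = 0 := by
    have := e.left_inv h0s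
    rwa [hecoe, hW0] at this
  have hev : ∀ᶠ w in nhds (0 : ℂ), w ∈ e.target ∧ e.symm w ∈ Metric.ball (0 : ℂ) r := by
    refine (e.open_target.eventually_mem h0t).and ?_
    apply (e.continuousAt_symm h0t).eventually_mem
    rw [hx0]; exact hnhds
  obtain ⟨ρ, hρ, hb⟩ := Metric.eventually_nhds_iff_ball.1 hev
  have hxd : ∀ w ∈ Metric.ball (0 : ℂ) ρ, HasDerivAt e.symm
      (Complex.exp (G (e.symm w)) * h (e.symm w))⁻¹ w := fun w hw =>
    e.hasDerivAt_symm (hb w hw).1 (hWne _) (hW _ (hb w hw).2)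
  refine ⟨ρ, hρ, e.symm, fun w hw => (hxd w hw).differentiableAt, hx0, ?_, ?_⟩
  · rw [(hxd 0 (Metric.mem_ball_self hρ)).deriv]
    exact inv_ne_zero (hWne _)
  · intro w hw
    rw [(hxd w hw).deriv, ← hhk _ (hb w hw).2, ← mul_pow]
    congr 1
    have hinv : e.symm w * Complex.exp (G (e.symm w)) = w := e.right_inv (hb w hw).1
    generalize e.symm w = x at hinv
    have h1 := hhne x
    have h2 := Complex.exp_ne_zero (G x)
    rw [← hinv]
    field_simp
end
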